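/- Let B be a nonempty closed subset of the Cantor set 𝒞, 𝒮 = 𝒮(B), and for I ∈ 𝒮 set ξ(I) = 1 if both the left child and the right child of I belong to 𝒮, and ξ(I) = 0 otherwise. Then 𝒮 can be partitioned into subsets each of which is totally ordered by inclusion (a chain), such that: every chain of the partition that possesses a minimal element I₀ satisfies ξ(I₀) = 1 and ξ(I) = 0 for every other element I of that chain; and every chain of the partition without a minimal element satisfies ξ(I) = 0 for all its elements. -/

import Mathlib

open Set

/-- A natural number is *digit-1-free* if its base-3 expansion contains no digit `1`. -/
def Digit1Free (n : ℕ) : Prop := ∀ k : ℕ, (n / 3 ^ k) % 3 ≠ 1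

/-- The closed interval `[n/3^m, (n+1)/3^m] ⊆ ℝ`. -/
noncomputable def triInterval (m n : ℕ) : Set ℝ :=
  Set.Icc ((n : ℝ) / 3 ^ m) (((n : ℝ) + 1) / 3 ^ m)

/-- The collection `ℐ^(m)` of level-`m` intervals `[n/3^m,(n+1)/3^m]` with `n` digit-1-free. -/
def CantorILevel (m : ℕ) : Set (Set ℝ) :=
  {S | ∃ n : ℕ, n < 3 ^ m ∧ Digit1Free n ∧ S = triInterval m n}

/-- The collection `ℐ` of all such intervals. -/
def CantorI : Set (Set ℝ) :=
  {S | ∃ m : ℕ, S ∈ CantorILevel m}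

/-- The ternary Cantor set: reals admitting a ternary expansion with all digits in `{0,2}`. -/
def ternaryCantorSet : Set ℝ :=
  {x | ∃ a : ℕ → ℕ, (∀ i, a i = 0 ∨ a i = 2) ∧ x = ∑' i : ℕ, (a i : ℝ) / 3 ^ (i + 1)}

/-- `𝒮(B) = {I ∈ ℐ : I ∩ B ≠ ∅}`. -/
def SB (B : Set ℝ) : Set (Set ℝ) := {I | I ∈ CantorI ∧ (I ∩ B).Nonempty}

open Classical in
/-- `ξ(I) = 1` if both the left child and the right child of `I` belong to `𝒮(B)`,
and `ξ(I) = 0` otherwise. -/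
noncomputable def xi (B : Set ℝ) (I : Set ℝ) : ℕ :=
  if ∃ m n : ℕ, n < 3 ^ m ∧ Digit1Free n ∧ I = triInterval m n ∧
      triInterval (m + 1) (3 * n) ∈ SB B ∧ triInterval (m + 1) (3 * n + 2) ∈ SB B
  then 1 else 0

theorem Digit1Free.even {n : ℕ} (h : Digit1Free n) : Even n := by
  induction n using Nat.strong_induction_on with
  | _ n ih =>
    rcases Nat.eq_zero_or_pos n with rfl | hn
    · exact Even.zero
    · have h3 : Digit1Free (n / 3) := fun k => by
        have := h (k + 1)
        rwa [pow_succ', ← Nat.div_div_eq_div_mul] at this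
      have he := ih (n / 3) (by omega) h3
      have h0 : n % 3 ≠ 1 := by simpa using h 0
      rw [Nat.even_iff] at he ⊢
      omega

theorem Digit1Free.div_pow {n : ℕ} (h : Digit1Free n) (j : ℕ) : Digit1Free (n / 3 ^ j) := by
  intro k
  rw [Nat.div_div_eq_div_mul, ← pow_add]
  exact h (j + k)

theorem Digit1Free.three_mul_add {n d : ℕ} (h : Digit1Free n) (hd : d = 0 ∨ d = 2) :
    Digit1Free (3 * n + d) := by
  rintro (_ | k)
  · rw [pow_zero, Nat.div_one]
    omega
  · rw [pow_succ', ← Nat.div_div_eq_div_mul, show (3 * n + d) / 3 = n by omega]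
    exact h k

theorem mem_triInterval {m n : ℕ} {x : ℝ} :
    x ∈ triInterval m n ↔ (n : ℝ) ≤ x * 3 ^ m ∧ x * 3 ^ m ≤ n + 1 := by
  have h : (0 : ℝ) < 3 ^ m := by positivity
  rw [triInterval, mem_Icc, div_le_iff₀ h, le_div_iff₀ h]

theorem triInterval_add_subset (m j p : ℕ) :
    triInterval (m + j) p ⊆ triInterval m (p / 3 ^ j) := by
  intro x hx
  rw [mem_triInterval, pow_add, ← mul_assoc] at hx
  rw [mem_triInterval]
  have h : (0 : ℝ) < 3 ^ j := by positivity
  have h1 : ((p / 3 ^ j : ℕ) : ℝ) * 3 ^ j ≤ p := by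
    exact_mod_cast Nat.div_mul_le_self p (3 ^ j)
  have h2 : (p : ℝ) + 1 ≤ (((p / 3 ^ j : ℕ) : ℝ) + 1) * 3 ^ j := by
    exact_mod_cast Nat.lt_mul_of_div_lt (Nat.lt_succ_self _) (by positivity)
  exact ⟨le_of_mul_le_mul_right (h1.trans hx.1) h, le_of_mul_le_mul_right (hx.2.trans h2) h⟩

/-- A triadic interval of level `m + j` meeting one of level `m` descends from it. -/
theorem div_pow_eq_of_mem_triInterval {m j n p : ℕ} (hn : Digit1Free n) (hp : Digit1Free p)
    {x : ℝ} (hxn : x ∈ triInterval m n) (hxp : x ∈ triInterval (m + j) p) : p / 3 ^ j = n := by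
  have hq := mem_triInterval.1 (triInterval_add_subset m j p hxp)
  rw [mem_triInterval] at hxn
  have h1 : p / 3 ^ j ≤ n + 1 := by exact_mod_cast hq.1.trans hxn.2
  have h2 : n ≤ p / 3 ^ j + 1 := by exact_mod_cast hxn.1.trans hq.2
  have e1 := Nat.even_iff.1 hn.even
  have e2 := Nat.even_iff.1 (hp.div_pow j).even
  omega

theorem triInterval_subset_of_mem {m k n p : ℕ} (hmk : m ≤ k) (hn : Digit1Free n)
    (hp : Digit1Free p) {x : ℝ} (hxn : x ∈ triInterval m n) (hxp : x ∈ triInterval k p) :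
    triInterval k p ⊆ triInterval m n := by
  obtain ⟨j, rfl⟩ := Nat.exists_eq_add_of_le hmk
  rw [← div_pow_eq_of_mem_triInterval hn hp hxn hxp]
  exact triInterval_add_subset m j p

theorem not_triInterval_subset_succ (m n p : ℕ) :
    ¬ triInterval m n ⊆ triInterval (m + 1) p := by
  intro h
  have hm : (0 : ℝ) < 3 ^ m := by positivity
  have h1 := mem_triInterval.1 (h (mem_triInterval.2
    (show (n : ℝ) ≤ n / 3 ^ m * 3 ^ m ∧ n / 3 ^ m * 3 ^ m ≤ (n : ℝ) + 1 by
      rw [div_mul_cancel₀ _ hm.ne']; exact ⟨le_rfl, by linarith⟩)))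
  have h2 := mem_triInterval.1 (h (mem_triInterval.2
    (show (n : ℝ) ≤ (n + 1) / 3 ^ m * 3 ^ m ∧ (n + 1) / 3 ^ m * 3 ^ m ≤ (n : ℝ) + 1 by
      rw [div_mul_cancel₀ _ hm.ne']; exact ⟨by linarith, le_rfl⟩)))
  rw [pow_succ, ← mul_assoc, div_mul_cancel₀ _ hm.ne'] at h1 h2
  linarith [h1.1, h2.2]

theorem subset_or_subset_of_mem_CantorI {I J : Set ℝ} (hI : I ∈ CantorI) (hJ : J ∈ CantorI)
    (h : (I ∩ J).Nonempty) : I ⊆ J ∨ J ⊆ I := by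
  obtain ⟨m, n, -, hn, rfl⟩ := hI
  obtain ⟨k, p, -, hp, rfl⟩ := hJ
  obtain ⟨x, hxn, hxp⟩ := h
  rcases le_total m k with hmk | hkm
  · exact Or.inr (triInterval_subset_of_mem hmk hn hp hxn hxp)
  · exact Or.inl (triInterval_subset_of_mem hkm hp hn hxp hxn)

theorem summable_ternary {a : ℕ → ℕ} (ha : ∀ i, a i = 0 ∨ a i = 2) :
    Summable fun i : ℕ => (a i : ℝ) / 3 ^ (i + 1) := by
  refine Summable.of_nonneg_of_le (fun i => by positivity) (fun i => ?_)
    (summable_geometric_of_lt_one (r := (1 / 3 : ℝ)) (by norm_num) (by norm_num))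
  have h : (a i : ℝ) ≤ 3 := by rcases ha i with h | h <;> rw [h] <;> norm_num
  rw [one_div_pow, pow_succ, div_le_div_iff₀ (by positivity) (by positivity)]
  nlinarith [pow_pos (show (0 : ℝ) < 3 by norm_num) i]

theorem ternaryCantorSet_subset_Icc : ternaryCantorSet ⊆ Icc 0 1 := by
  rintro x ⟨a, ha, rfl⟩
  refine ⟨tsum_nonneg fun i => by positivity, ?_⟩
  have hg := (hasSum_geometric_of_lt_one (r := (1 / 3 : ℝ)) (by norm_num) (by norm_num)).mul_left
    (2 / 3 : ℝ)
  refine ((summable_ternary ha).tsum_le_tsum (fun i => ?_) hg.summable).trans ?_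
  · have h : (a i : ℝ) ≤ 2 := by rcases ha i with h | h <;> rw [h] <;> norm_num
    calc (a i : ℝ) / 3 ^ (i + 1) ≤ 2 / 3 ^ (i + 1) := by gcongr
      _ = 2 / 3 * (1 / 3) ^ i := by rw [one_div_pow, pow_succ]; field_simp
  · rw [hg.tsum_eq]
    norm_num

theorem exists_digit_of_mem_ternaryCantorSet {x : ℝ} (hx : x ∈ ternaryCantorSet) :
    ∃ d : ℕ, (d = 0 ∨ d = 2) ∧ ∃ y ∈ ternaryCantorSet, x = (d + y) / 3 := by
  obtain ⟨a, ha, rfl⟩ := hx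
  refine ⟨a 0, ha 0, _, ⟨fun i => a (i + 1), fun i => ha (i + 1), rfl⟩, ?_⟩
  rw [(summable_ternary ha).tsum_eq_zero_add, add_div, ← tsum_div_const]
  congr 1
  · simp
  · refine tsum_congr fun i => ?_
    rw [pow_succ _ (i + 1), div_div]

theorem exists_mem_triInterval_of_mem_ternaryCantorSet {x : ℝ} (hx : x ∈ ternaryCantorSet)
    (m : ℕ) : ∃ n : ℕ, Digit1Free n ∧ x ∈ triInterval m n := by
  suffices h : ∃ n : ℕ, Digit1Free n ∧ ∃ y ∈ ternaryCantorSet, x * 3 ^ m = n + y by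
    obtain ⟨n, hn, y, hy, hxy⟩ := h
    have hy' := ternaryCantorSet_subset_Icc hy
    refine ⟨n, hn, mem_triInterval.2 ?_⟩
    rw [hxy]
    exact ⟨by linarith [hy'.1], by linarith [hy'.2]⟩
  induction m with
  | zero => exact ⟨0, fun k => by simp, x, hx, by simp⟩
  | succ m ih =>
    obtain ⟨n, hn, y, hy, hxy⟩ := ih
    obtain ⟨d, hd, z, hz, rfl⟩ := exists_digit_of_mem_ternaryCantorSet hy
    refine ⟨3 * n + d, hn.three_mul_add hd, z, hz, ?_⟩
    rw [pow_succ, ← mul_assoc, hxy]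
    push_cast
    ring

theorem mem_child_of_mem_triInterval {m n : ℕ} (hn : Digit1Free n) {x : ℝ}
    (hx : x ∈ ternaryCantorSet) (hxn : x ∈ triInterval m n) :
    x ∈ triInterval (m + 1) (3 * n) ∨ x ∈ triInterval (m + 1) (3 * n + 2) := by
  obtain ⟨p, hp, hxp⟩ := exists_mem_triInterval_of_mem_ternaryCantorSet hx (m + 1)
  have h := div_pow_eq_of_mem_triInterval hn hp hxn hxp
  have h0 : p % 3 ≠ 1 := by simpa using hp 0
  rw [pow_one] at h
  rcases (by omega : p = 3 * n ∨ p = 3 * n + 2) with rfl | rfl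
  · exact Or.inl hxp
  · exact Or.inr hxp

theorem child_subset_triInterval (m n : ℕ) {d : ℕ} (hd : d = 0 ∨ d = 2) :
    triInterval (m + 1) (3 * n + d) ⊆ triInterval m n := by
  have h := triInterval_add_subset m 1 (3 * n + d)
  rwa [pow_one, show (3 * n + d) / 3 = n by omega] at h

theorem child_mem_CantorI {m n d : ℕ} (hlt : n < 3 ^ m) (hn : Digit1Free n)
    (hd : d = 0 ∨ d = 2) : triInterval (m + 1) (3 * n + d) ∈ CantorI :=
  ⟨m + 1, _, by rw [pow_succ]; omega, hn.three_mul_add hd, rfl⟩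

/-- If a smaller interval has the same trace on `B`, then only one child of `I` meets `B`. -/
theorem xi_eq_zero_of_inter_eq {B I J : Set ℝ} (hJ : J ∈ CantorI) (hIJ : ¬ I ⊆ J)
    (h : I ∩ B = J ∩ B) : xi B I = 0 := by
  refine if_neg ?_
  rintro ⟨m, n, -, hn, rfl, ⟨-, x, hx, hxB⟩, ⟨-, y, hy, hyB⟩⟩
  obtain ⟨k, p, -, hp, rfl⟩ := hJ
  have hxI : x ∈ triInterval m n := child_subset_triInterval m n (Or.inl rfl) hx
  have hyI : y ∈ triInterval m n := child_subset_triInterval m n (Or.inr rfl) hy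
  have hxJ : x ∈ triInterval k p := (h.subset ⟨hxI, hxB⟩).1
  have hyJ : y ∈ triInterval k p := (h.subset ⟨hyI, hyB⟩).1
  rcases Nat.lt_or_ge m k with hmk | hkm
  · obtain ⟨j, rfl⟩ := Nat.exists_eq_add_of_le (Nat.succ_le_of_lt hmk)
    have e0 := div_pow_eq_of_mem_triInterval (hn.three_mul_add (Or.inl rfl)) hp hx hxJ
    have e2 := div_pow_eq_of_mem_triInterval (hn.three_mul_add (Or.inr rfl)) hp hy hyJ
    omega
  · exact hIJ (triInterval_subset_of_mem hkm hp hn hxJ hxI)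

/-- If only one child of `I` meets `B`, that child has the same trace on `B` as `I`. -/
theorem exists_inter_eq_of_xi_ne_one {B I : Set ℝ} (hB : B ⊆ ternaryCantorSet) (hI : I ∈ SB B)
    (hxi : xi B I ≠ 1) : ∃ J ∈ SB B, J ∩ B = I ∩ B ∧ ¬ I ⊆ J := by
  obtain ⟨⟨m, n, hlt, hn, rfl⟩, hne⟩ := hI
  suffices h : ∃ d : ℕ, (d = 0 ∨ d = 2) ∧
      triInterval m n ∩ B ⊆ triInterval (m + 1) (3 * n + d) by
    obtain ⟨d, hd, h⟩ := h
    have heq : triInterval (m + 1) (3 * n + d) ∩ B = triInterval m n ∩ B :=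
      Subset.antisymm (inter_subset_inter_left B (child_subset_triInterval m n hd))
        (subset_inter h inter_subset_right)
    exact ⟨_, ⟨child_mem_CantorI hlt hn hd, heq ▸ hne⟩, heq, not_triInterval_subset_succ m n _⟩
  by_contra! hcon
  obtain ⟨x, ⟨hxI, hxB⟩, hx⟩ := not_subset.1 (hcon 0 (Or.inl rfl))
  obtain ⟨y, ⟨hyI, hyB⟩, hy⟩ := not_subset.1 (hcon 2 (Or.inr rfl))
  have hx' := (mem_child_of_mem_triInterval hn (hB hxB) hxI).resolve_left hx
  have hy' := (mem_child_of_mem_triInterval hn (hB hyB) hyI).resolve_right hy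
  exact hxi (if_pos ⟨m, n, hlt, hn, rfl,
    ⟨child_mem_CantorI hlt hn (Or.inl rfl), y, hy', hyB⟩,
    ⟨child_mem_CantorI hlt hn (Or.inr rfl), x, hx', hxB⟩⟩)

/-- `𝒮(B)` can be partitioned into chains (under inclusion) such that any chain with a
minimal element `I₀` has `ξ(I₀) = 1` and `ξ(I) = 0` for every other element of the chain,
while any chain without a minimal element has `ξ ≡ 0` on it. -/
theorem stmt_14 (B : Set ℝ) (hne : B.Nonempty) (hcl : IsClosed B)
    (hB : B ⊆ ternaryCantorSet) :
    ∃ P : Set (Set (Set ℝ)),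
      (∀ C ∈ P, C.Nonempty) ∧
      (∀ C ∈ P, C ⊆ SB B) ∧
      (⋃₀ P = SB B) ∧
      (P.PairwiseDisjoint id) ∧
      (∀ C ∈ P, IsChain (· ⊆ ·) C) ∧
      (∀ C ∈ P,
        (∃ I₀ ∈ C, (∀ I ∈ C, I₀ ⊆ I) ∧ xi B I₀ = 1 ∧ ∀ I ∈ C, I ≠ I₀ → xi B I = 0) ∨
        ((¬ ∃ I₀ ∈ C, ∀ I ∈ C, I₀ ⊆ I) ∧ ∀ I ∈ C, xi B I = 0)) := by
  -- The chains are the fibres of `I ↦ I ∩ B`.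
  have hcomp : ∀ I ∈ SB B, ∀ J ∈ SB B, I ∩ B = J ∩ B → I ⊆ J ∨ J ⊆ I := by
    intro I hI J hJ h
    obtain ⟨x, hx⟩ := hI.2
    exact subset_or_subset_of_mem_CantorI hI.1 hJ.1 ⟨x, hx.1, (h.subset hx).1⟩
  refine ⟨(fun I => {J ∈ SB B | J ∩ B = I ∩ B}) '' SB B, ?_, ?_, ?_, ?_, ?_, ?_⟩
  · rintro _ ⟨I, hI, rfl⟩
    exact ⟨I, hI, rfl⟩
  · rintro _ ⟨I, hI, rfl⟩
    exact sep_subset _ _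
  · refine Subset.antisymm (sUnion_subset ?_) fun I hI => ⟨_, ⟨I, hI, rfl⟩, hI, rfl⟩
    rintro _ ⟨I, hI, rfl⟩
    exact sep_subset _ _
  · rintro _ ⟨I, hI, rfl⟩ _ ⟨J, hJ, rfl⟩ hne
    refine disjoint_left.2 fun K hKI hKJ => hne ?_
    simp only [← hKI.2, ← hKJ.2]
  · rintro _ ⟨I, hI, rfl⟩ J hJ K hK -
    exact hcomp J hJ.1 K hK.1 (hJ.2.trans hK.2.symm)
  · rintro _ ⟨I, hI, rfl⟩
    by_cases h : ∃ I₀ ∈ {J ∈ SB B | J ∩ B = I ∩ B}, ∀ J ∈ {J ∈ SB B | J ∩ B = I ∩ B}, I₀ ⊆ J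
    · obtain ⟨I₀, hI₀, hmin⟩ := h
      refine Or.inl ⟨I₀, hI₀, hmin, ?_, fun J hJ hne => ?_⟩
      · by_contra hxi
        obtain ⟨J, hJ, hJB, hsub⟩ := exists_inter_eq_of_xi_ne_one hB hI₀.1 hxi
        exact hsub (hmin J ⟨hJ, hJB.trans hI₀.2⟩)
      · exact xi_eq_zero_of_inter_eq hI₀.1.1 (fun hs => hne (hs.antisymm (hmin J hJ)))
          (hJ.2.trans hI₀.2.symm)
    · refine Or.inr ⟨h, fun J hJ => ?_⟩
      push Not at h
      obtain ⟨K, hK, hJK⟩ := h J hJ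
      exact xi_eq_zero_of_inter_eq hK.1.1 hJK (hJ.2.trans hK.2.symm)
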